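/- arXiv:1107.1510 — 13 statements merged into one kernel-verified Lean document; each statement's English description precedes it below -/
import Mathlib

section
/- A topological space Y has the almost everywhere equality property (AEEP) if and only if the diagonal Δ_Y = {(y,y) : y ∈ Y} belongs to the product σ-algebra B(Y) ⊗ B(Y), where B(Y) denotes the Borel σ-algebra of Y. -/
open MeasureTheory

universe u

/-- A topological space `Y` has the almost everywhere equality property (AEEP) if for every
measurable space `(X, M)` and every pair of Borel-measurable functions `f g : X → Y`
(i.e. preimages of open sets are in `M`), the set `{x | f x = g x}` belongs to `M`. -/
def HasAEEP (Y : Type u) [TopologicalSpace Y] : Prop :=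
  ∀ (X : Type u) (M : MeasurableSpace X) (f g : X → Y),
    (∀ U : Set Y, IsOpen U → MeasurableSet[M] (f ⁻¹' U)) →
    (∀ U : Set Y, IsOpen U → MeasurableSet[M] (g ⁻¹' U)) →
    MeasurableSet[M] {x | f x = g x}

theorem stmt_0 (Y : Type u) [TopologicalSpace Y] :
    HasAEEP Y ↔
      MeasurableSet[(borel Y).prod (borel Y)] {p : Y × Y | p.1 = p.2} := by
  constructor
  · intro h
    exact h (Y × Y) ((borel Y).prod (borel Y)) Prod.fst Prod.snd
      (fun U hU => (@measurable_fst Y Y (borel Y) (borel Y))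
        (MeasurableSpace.measurableSet_generateFrom hU))
      (fun U hU => (@measurable_snd Y Y (borel Y) (borel Y))
        (MeasurableSpace.measurableSet_generateFrom hU))
  · intro h X M f g hf hg
    have hf' : @Measurable X Y M (borel Y) f :=
      @measurable_generateFrom X Y M _ _ hf
    have hg' : @Measurable X Y M (borel Y) g :=
      @measurable_generateFrom X Y M _ _ hg
    exact (hf'.prodMk hg') h
end

section
/- For an arbitrary topological space Y, every member F of the product σ-algebra B(Y) ⊗ B(Y) may be written in the form F = ⋃_{t ∈ [0,1]} (A_t × B_t), where A_t, B_t ∈ B(Y) for every t ∈ [0,1]. -/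
open MeasureTheory

/-- A set in a product σ-algebra is determined by the coordinatewise membership pattern in some
sequence of measurable sets. -/
lemma exists_seq_measurableSet_mem_iff_of_measurableSet_prod {Y : Type*} (m : MeasurableSpace Y)
    {F : Set (Y × Y)} (hF : MeasurableSet[m.prod m] F) :
    ∃ s : ℕ → Set Y, (∀ n, MeasurableSet[m] (s n)) ∧
      ∀ x x' y y', (∀ n, x ∈ s n ↔ x' ∈ s n) → (∀ n, y ∈ s n ↔ y' ∈ s n) →
        ((x, y) ∈ F ↔ (x', y') ∈ F) := by
  induction F, hF using MeasurableSpace.induction_on_inter generateFrom_prod.symm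
    isPiSystem_prod with
  | empty => exact ⟨fun _ => ∅, fun _ => MeasurableSet.empty, by simp⟩
  | basic t ht =>
    obtain ⟨A, hA, B, hB, rfl⟩ := ht
    refine ⟨fun n => if n = 0 then A else B, fun n => ?_, fun x x' y y' hx hy => ?_⟩
    · dsimp only
      split_ifs
      exacts [hA, hB]
    · have h₀ := hx 0
      have h₁ := hy 1
      simp only [if_true, one_ne_zero, if_false] at h₀ h₁
      simp [h₀, h₁]
  | compl t _ ih =>
    obtain ⟨s, hs, h⟩ := ih
    exact ⟨s, hs, fun x x' y y' hx hy => not_congr (h x x' y y' hx hy)⟩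
  | iUnion f _ _ ih =>
    choose s hs h using ih
    refine ⟨fun n => s n.unpair.1 n.unpair.2, fun n => hs _ _, fun x x' y y' hx hy => ?_⟩
    simp only [Set.mem_iUnion]
    refine exists_congr fun i => h i x x' y y' (fun n => ?_) (fun n => ?_)
    · simpa using hx (Nat.pair i n)
    · simpa using hy (Nat.pair i n)

lemma measurableSet_setOf_mem_eq {Y : Type*} [MeasurableSpace Y] {s : ℕ → Set Y}
    (hs : ∀ n, MeasurableSet (s n)) (p : Set ℕ) : MeasurableSet {x | {n | x ∈ s n} = p} := by
  simp only [Set.ext_iff, Set.mem_ofPred_eq]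
  exact measurableSet_setOfPred.2 (Measurable.forall fun n =>
    (measurable_mem.2 (hs n)).iff measurable_const)

lemma nonempty_unitInterval_equiv_set_nat_prod :
    Nonempty (Set.Icc (0 : ℝ) 1 ≃ Set ℕ × Set ℕ) := by
  refine Cardinal.eq.1 ?_
  simp [Cardinal.mk_Icc_real]

theorem stmt_3 {Y : Type*} [TopologicalSpace Y] (F : Set (Y × Y))
    (hF : MeasurableSet[(borel Y).prod (borel Y)] F) :
    ∃ A B : Set.Icc (0 : ℝ) 1 → Set Y,
      (∀ t, MeasurableSet[borel Y] (A t)) ∧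
      (∀ t, MeasurableSet[borel Y] (B t)) ∧
      F = ⋃ t, A t ×ˢ B t := by
  obtain ⟨s, hs, h⟩ := exists_seq_measurableSet_mem_iff_of_measurableSet_prod _ hF
  obtain ⟨e⟩ := nonempty_unitInterval_equiv_set_nat_prod
  let : MeasurableSpace Y := borel Y
  let code : Y → Set ℕ := fun x => {n | x ∈ s n}
  have hcode : ∀ p, MeasurableSet {x | code x = p} := measurableSet_setOf_mem_eq hs
  refine ⟨fun t => {x | code x = (e t).1 ∧ ∃ z ∈ F, (code z.1, code z.2) = e t},
    fun t => {y | code y = (e t).2}, fun t => (hcode _).inter (.const _), fun t => hcode _, ?_⟩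
  ext ⟨x, y⟩
  simp only [Set.mem_iUnion, Set.mem_prod, Set.mem_ofPred_eq]
  constructor
  · intro hxy
    exact ⟨e.symm (code x, code y), ⟨by simp, (x, y), hxy, by simp⟩, by simp⟩
  · rintro ⟨t, ⟨hx, ⟨u, v⟩, huv, hz⟩, hy⟩
    rw [← hz] at hx hy
    exact (h x u y v (Set.ext_iff.1 hx) (Set.ext_iff.1 hy)).2 huv
end

section
/- If a topological space Y has the almost everywhere equality property (AEEP), then the cardinality of Y is at most 2^{ℵ₀}. -/
open MeasureTheory

universe u

/-- Membership in a set of the σ-algebra generated by the cylinders over `Y` in `Y × Y` is determined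
by countably many subsets of `Y`. -/
theorem exists_seq_determining_of_measurableSet_cylinders {Y : Type*} {s : Set (Y × Y)}
    (hs : MeasurableSet[MeasurableSpace.generateFrom
      {t : Set (Y × Y) | ∃ U : Set Y, t = Prod.fst ⁻¹' U ∨ t = Prod.snd ⁻¹' U}] s) :
    ∃ A : ℕ → Set Y, ∀ p q : Y × Y, (∀ n, p.1 ∈ A n ↔ q.1 ∈ A n) →
      (∀ n, p.2 ∈ A n ↔ q.2 ∈ A n) → (p ∈ s ↔ q ∈ s) := by
  induction s, hs using MeasurableSpace.generateFrom_induction with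
  | hC t ht _ =>
    obtain ⟨U, rfl | rfl⟩ := ht
    · exact ⟨fun _ => U, fun p q h₁ _ => h₁ 0⟩
    · exact ⟨fun _ => U, fun p q _ h₂ => h₂ 0⟩
  | empty => exact ⟨fun _ => ∅, fun p q _ _ => Iff.rfl⟩
  | compl t _ ih =>
    obtain ⟨A, hA⟩ := ih
    exact ⟨A, fun p q h₁ h₂ => not_congr (hA p q h₁ h₂)⟩
  | iUnion t _ ih =>
    choose A hA using ih
    refine ⟨fun n => A n.unpair.1 n.unpair.2, fun p q h₁ h₂ => ?_⟩
    simp only [Set.mem_iUnion]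
    refine exists_congr fun i => hA i p q (fun n => ?_) (fun n => ?_)
    · simpa using h₁ (Nat.pair i n)
    · simpa using h₂ (Nat.pair i n)

theorem stmt_6 (Y : Type u) [TopologicalSpace Y] (h : HasAEEP Y) :
    Cardinal.mk Y ≤ 2 ^ Cardinal.aleph0 := by
  obtain ⟨A, hA⟩ := exists_seq_determining_of_measurableSet_cylinders
    (h (Y × Y) _ Prod.fst Prod.snd
      (fun U _ => MeasurableSpace.measurableSet_generateFrom ⟨U, Or.inl rfl⟩)
      (fun U _ => MeasurableSpace.measurableSet_generateFrom ⟨U, Or.inr rfl⟩))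
  have hinj : Function.Injective fun (y : Y) => {n : ℕ | y ∈ A n} := fun x y hxy =>
    (hA (x, x) (x, y) (fun _ => Iff.rfl) (fun n => Set.ext_iff.1 hxy n)).1 rfl
  simpa using Cardinal.mk_le_of_injective (Equiv.ulift.{u}.symm.injective.comp hinj)
end

section
/- If a topological space Y has a diagonal Δ_Y = {(y,y) : y ∈ Y} belonging to the product σ-algebra B(Y) ⊗ B(Y), then the cardinality of Y is at most 2^{ℵ₀}. -/
open MeasureTheory

/-- Membership in a set of the product σ-algebra is determined by countably many yes/no
questions about each of the two coordinates. -/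
theorem MeasurableSpace.exists_forall_mem_iff_of_measurableSet_prod {α β : Type*}
    {m₁ : MeasurableSpace α} {m₂ : MeasurableSpace β} {s : Set (α × β)}
    (hs : MeasurableSet[m₁.prod m₂] s) :
    ∃ (f : α → Set ℕ) (g : β → Set ℕ), ∀ a a' b b', f a = f a' → g b = g b' →
      ((a, b) ∈ s ↔ (a', b') ∈ s) := by
  have hprod := @generateFrom_prod α β m₁ m₂
  change _ = m₁.prod m₂ at hprod
  rw [← hprod] at hs
  induction s, hs using MeasurableSpace.generateFrom_induction with
  | hC t ht _ =>
    obtain ⟨u, -, v, -, rfl⟩ := ht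
    refine ⟨fun a ↦ {_n | a ∈ u}, fun b ↦ {_n | b ∈ v}, fun a a' b b' ha hb ↦ ?_⟩
    have hu : a ∈ u ↔ a' ∈ u := Set.ext_iff.1 ha 0
    have hv : b ∈ v ↔ b' ∈ v := Set.ext_iff.1 hb 0
    simp only [Set.mem_prod, hu, hv]
  | empty => exact ⟨fun _ ↦ ∅, fun _ ↦ ∅, by simp⟩
  | compl t _ ih =>
    obtain ⟨f, g, h⟩ := ih
    exact ⟨f, g, fun a a' b b' ha hb ↦ not_congr (h a a' b b' ha hb)⟩
  | iUnion t _ ih =>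
    choose f g h using ih
    refine ⟨fun a ↦ {k | k.unpair.2 ∈ f k.unpair.1 a}, fun b ↦ {k | k.unpair.2 ∈ g k.unpair.1 b},
      fun a a' b b' ha hb ↦ ?_⟩
    simp only [Set.mem_iUnion]
    refine exists_congr fun n ↦ h n a a' b b' ?_ ?_
    · ext k
      simpa using Set.ext_iff.1 ha (Nat.pair n k)
    · ext k
      simpa using Set.ext_iff.1 hb (Nat.pair n k)

theorem stmt_7 {Y : Type*} [TopologicalSpace Y]
    (h : MeasurableSet[(borel Y).prod (borel Y)] {p : Y × Y | p.1 = p.2}) :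
    Cardinal.mk Y ≤ 2 ^ Cardinal.aleph0 := by
  obtain ⟨f, g, hfg⟩ := MeasurableSpace.exists_forall_mem_iff_of_measurableSet_prod h
  have hg : Function.Injective g := fun x y hxy ↦ (hfg x x x y rfl hxy).1 rfl
  simpa using Cardinal.lift_mk_le_lift_mk_of_injective hg
end

section
/- Every metrizable topological space Y with cardinality at most 2^{ℵ₀} admits a continuous one-to-one (injective) function from Y into a separable metrizable topological space. -/
/-- A metrizable space which injects into `ℝ` has countably many continuous real functions
that separate its points. -/
theorem exists_countable_separating_continuous {Y : Type*} [TopologicalSpace Y]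
    [TopologicalSpace.MetrizableSpace Y] (c : Y → ℝ) (hc : Function.Injective c) :
    ∃ f : ℕ × TopologicalSpace.countableBasis ℝ → Y → ℝ,
      (∀ k, Continuous (f k)) ∧ ∀ y z, (∀ k, f k y = f k z) → y = z := by
  classical
  let := TopologicalSpace.metrizableSpaceMetric Y
  have hpart (n : ℕ) : ∃ φ : PartitionOfUnity Y Y,
      φ.IsSubordinate fun i ↦ Metric.ball i (1 / ((n : ℝ) + 1)) := by
    refine PartitionOfUnity.exists_isSubordinate isClosed_univ _ (fun _ ↦ Metric.isOpen_ball) ?_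
    exact fun y _ ↦ Set.mem_iUnion.2 ⟨y, Metric.mem_ball_self (by positivity)⟩
  choose φ hφ using hpart
  refine ⟨fun k y ↦ ∑ᶠ i, φ k.1 i y • (if c i ∈ (k.2 : Set ℝ) then (1 : ℝ) else 0),
    fun k ↦ (φ k.1).continuous_finsum_smul (g := fun i _ ↦ if c i ∈ (k.2 : Set ℝ) then 1 else 0)
      fun i x _ ↦ continuousAt_const, fun y z h ↦ ?_⟩
  by_contra hne
  obtain ⟨n, hn⟩ := exists_nat_one_div_lt (half_pos (dist_pos.2 hne))
  obtain ⟨i, hi⟩ := (φ n).exists_pos (Set.mem_univ y)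
  have mem_ball {j x : Y} (hx : φ n j x ≠ 0) : dist x j < 1 / ((n : ℝ) + 1) :=
    hφ n j (subset_tsupport _ hx)
  have hfin (x : Y) : {j | φ n j x ≠ 0}.Finite := (φ n).locallyFinite.point_finite x
  have hiz : φ n i z = 0 := by
    by_contra hz
    linarith [mem_ball hi.ne', mem_ball hz, dist_triangle_right y z i]
  obtain ⟨C, hC, hiC, hCsub⟩ :=
    (TopologicalSpace.isBasis_countableBasis ℝ).exists_subset_of_mem_open
      (a := c i) (u := (c '' {j | φ n j z ≠ 0})ᶜ)
      (by rintro ⟨j, hj, hji⟩; exact hj (hc hji ▸ hiz))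
      ((hfin z).image c).isClosed.isOpen_compl
  have hyz := h (n, ⟨C, hC⟩)
  dsimp only at hyz
  have hzero : ∑ᶠ j, φ n j z • (if c j ∈ C then (1 : ℝ) else 0) = 0 := by
    refine finsum_eq_zero_of_forall_eq_zero fun j ↦ ?_
    by_cases hj : φ n j z = 0
    · simp [hj]
    · have : c j ∉ C := fun hjC ↦ hCsub hjC ⟨j, hj, rfl⟩
      simp [this]
  have hpos : 0 < ∑ᶠ j, φ n j y • (if c j ∈ C then (1 : ℝ) else 0) := by
    refine finsum_pos (fun j ↦ ?_) ⟨i, by simpa [hiC] using hi⟩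
      ((hfin y).subset fun j hj hj0 ↦ hj (by simp [hj0]))
    have := (φ n).nonneg j y
    split_ifs <;> simp [this]
  exact hpos.ne' (hyz.trans hzero)

universe u

theorem stmt_8 (Y : Type u) [TopologicalSpace Y] [TopologicalSpace.MetrizableSpace Y]
    (hY : Cardinal.mk Y ≤ 2 ^ Cardinal.aleph0) :
    ∃ (X : Type u) (tX : TopologicalSpace X),
      @TopologicalSpace.MetrizableSpace X tX ∧ @TopologicalSpace.SeparableSpace X tX ∧
      ∃ u : Y → X, @Continuous Y X _ tX u ∧ Function.Injective u := by
  obtain ⟨c⟩ : Nonempty (Y ↪ ℝ) := by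
    rw [← Cardinal.lift_mk_le', Cardinal.mk_real, Cardinal.lift_continuum]
    simpa using hY
  obtain ⟨f, hf, hsep⟩ := exists_countable_separating_continuous c c.injective
  have hcount : Countable (TopologicalSpace.countableBasis ℝ) :=
    (TopologicalSpace.countable_countableBasis ℝ).to_subtype
  let F : Y → ℕ × TopologicalSpace.countableBasis ℝ → ℝ := fun y k ↦ f k y
  have hF : Function.Injective F := fun y z h ↦ hsep y z fun k ↦ congrFun h k
  have hFc : Continuous F := continuous_pi hf
  let tX : TopologicalSpace Y := .induced F inferInstance
  have hemb : @Topology.IsEmbedding Y _ tX _ F := ⟨⟨rfl⟩, hF⟩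
  have hsc : @SecondCountableTopology Y tX := hemb.secondCountableTopology
  exact ⟨Y, tX, hemb.metrizableSpace, inferInstance, id, continuous_induced_rng.2 hFc,
    Function.injective_id⟩
end

section
/- Let Y be a topological space and suppose there exists a continuous injective function u : Y → X into a separable metrizable topological space X. Then the diagonal Δ_Y = {(y,y) : y ∈ Y} belongs to the product σ-algebra B(Y) ⊗ B(Y). -/
open MeasureTheory

theorem stmt_9 {Y X : Type*} [TopologicalSpace Y] [TopologicalSpace X]
    [TopologicalSpace.MetrizableSpace X] [TopologicalSpace.SeparableSpace X]
    (u : Y → X) (hu : Continuous u) (hinj : Function.Injective u) :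
    MeasurableSet[(borel Y).prod (borel Y)] {p : Y × Y | p.1 = p.2} := by
  borelize X Y
  let _ := TopologicalSpace.metrizableSpaceMetric X
  have : SecondCountableTopology X := UniformSpace.secondCountable_of_separable X
  have hdiag : MeasurableSet (Set.diagonal X) := isClosed_diagonal.measurableSet
  have hpre : MeasurableSet (Prod.map u u ⁻¹' Set.diagonal X) :=
    (hu.measurable.prodMap hu.measurable) hdiag
  have heq : {p : Y × Y | p.1 = p.2} = Prod.map u u ⁻¹' Set.diagonal X := by
    ext p
    exact hinj.eq_iff.symm
  rw [heq]
  exact hpre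
end

section
/- Let Y be a topological space and suppose there exists a continuous injective function u : Y → X into a separable metrizable topological space X. Then Y has the almost everywhere equality property (AEEP): for every measurable space (Ω, M) and every pair of Borel-measurable functions f, g : Ω → Y, the set {ω ∈ Ω : f(ω) = g(ω)} belongs to M. -/
open MeasureTheory

theorem stmt_10 {Y X : Type*} [TopologicalSpace Y] [TopologicalSpace X]
    [TopologicalSpace.MetrizableSpace X] [TopologicalSpace.SeparableSpace X]
    (u : Y → X) (hu : Continuous u) (hinj : Function.Injective u)
    {Ω : Type*} (M : MeasurableSpace Ω) (f g : Ω → Y)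
    (hf : ∀ U : Set Y, IsOpen U → MeasurableSet[M] (f ⁻¹' U))
    (hg : ∀ U : Set Y, IsOpen U → MeasurableSet[M] (g ⁻¹' U)) :
    MeasurableSet[M] {ω | f ω = g ω} := by
  let _ : MetricSpace X := TopologicalSpace.metrizableSpaceMetric X
  have : SecondCountableTopology X := UniformSpace.secondCountable_of_separable X
  borelize X
  have huf : Measurable fun ω => u (f ω) :=
    measurable_of_isOpen fun U hU => hf _ (hU.preimage hu)
  have hug : Measurable fun ω => u (g ω) :=
    measurable_of_isOpen fun U hU => hg _ (hU.preimage hu)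
  simpa only [hinj.eq_iff] using measurableSet_eq_fun huf hug
end

section
/- Every metrizable topological space Y with cardinality at most 2^{ℵ₀} has the almost everywhere equality property (AEEP): for every measurable space (X, M) and every pair of Borel-measurable functions f, g : X → Y, the set {x ∈ X : f(x) = g(x)} belongs to M. -/
open MeasureTheory

/-- In a second countable T1 space, countably many sets suffice to separate disjoint finite sets. -/
theorem exists_countable_separating_finite (Z : Type*) [TopologicalSpace Z]
    [SecondCountableTopology Z] [T1Space Z] :
    ∃ 𝒞 : Set (Set Z), 𝒞.Countable ∧ ∀ F G : Set Z, F.Finite → G.Finite → Disjoint F G →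
      ∃ C ∈ 𝒞, F ⊆ C ∧ Disjoint C G := by
  obtain ⟨B, hBc, -, hB⟩ := TopologicalSpace.exists_countable_basis Z
  refine ⟨Set.sUnion '' {s | s.Finite ∧ s ⊆ B}, (Set.countable_ofPred_finite_subset hBc).image _,
    fun F G hF hG hFG => ?_⟩
  have hb : ∀ c : F, ∃ b ∈ B, (c : Z) ∈ b ∧ b ⊆ Gᶜ := fun c =>
    hB.exists_subset_of_mem_open (Set.disjoint_left.1 hFG c.2) hG.isClosed.isOpen_compl
  choose b hbB hcb hbG using hb
  have := hF.to_subtype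
  refine ⟨_, ⟨Set.range b, ⟨Set.finite_range b, Set.range_subset_iff.2 hbB⟩, rfl⟩,
    fun c hc => ⟨_, ⟨⟨c, hc⟩, rfl⟩, hcb _⟩, ?_⟩
  rw [Set.disjoint_left]
  rintro z ⟨_, ⟨c, rfl⟩, hz⟩
  exact hbG c hz

/-- In a metrizable space with at most continuum many points, countably many open sets separate
the points. -/
theorem exists_countable_isOpen_separating {Y : Type*} [TopologicalSpace Y]
    [TopologicalSpace.MetrizableSpace Y] (hY : Cardinal.mk Y ≤ 2 ^ Cardinal.aleph0) :
    ∃ 𝒰 : Set (Set Y), 𝒰.Countable ∧ (∀ U ∈ 𝒰, IsOpen U) ∧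
      ∀ x y, (∀ U ∈ 𝒰, x ∈ U ↔ y ∈ U) → x = y := by
  let := TopologicalSpace.metrizableSpaceMetric Y
  obtain ⟨e⟩ : Nonempty (Y ↪ ℝ) := by
    rw [← Cardinal.lift_mk_le', Cardinal.mk_real, Cardinal.lift_continuum, Cardinal.lift_uzero]
    rwa [Cardinal.two_power_aleph0] at hY
  obtain ⟨𝒞, h𝒞, hsep⟩ := exists_countable_separating_finite ℝ
  have hv : ∀ n : ℕ, ∃ v : Y → Set Y, (∀ a, IsOpen (v a)) ∧ ⋃ a, v a = Set.univ ∧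
      LocallyFinite v ∧ ∀ a, v a ⊆ Metric.ball a (1 / ((n : ℝ) + 1)) := fun n =>
    precise_refinement _ (fun _ => Metric.isOpen_ball) (Set.eq_univ_of_forall fun a =>
      Set.mem_iUnion.2 ⟨a, Metric.mem_ball_self Nat.one_div_pos_of_nat⟩)
  choose v hvo hvc hvf hvb using hv
  let W : ℕ × Set ℝ → Set Y := fun p => ⋃ a ∈ e ⁻¹' p.2, v p.1 a
  refine ⟨W '' (Set.univ ×ˢ 𝒞), (Set.countable_univ.prod h𝒞).image _, ?_, fun x y hxy => ?_⟩
  · rintro _ ⟨p, -, rfl⟩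
    exact isOpen_biUnion fun a _ => hvo _ a
  by_contra hne
  obtain ⟨n, hn⟩ := exists_nat_one_div_lt (half_pos (dist_pos.2 hne))
  obtain ⟨C, hC, hFC, hCG⟩ := hsep (e '' {a | x ∈ v n a}) (e '' {a | y ∈ v n a})
    (((hvf n).point_finite x).image _) (((hvf n).point_finite y).image _) (by
      rw [Set.disjoint_image_iff e.injective, Set.disjoint_left]
      intro a hx hy
      have h₁ := Metric.mem_ball.1 (hvb n a hx)
      have h₂ := Metric.mem_ball.1 (hvb n a hy)
      linarith [dist_triangle_right x y a])
  have hW := hxy (W (n, C)) ⟨_, ⟨Set.mem_univ _, hC⟩, rfl⟩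
  obtain ⟨a, ha⟩ := Set.mem_iUnion.1 (hvc n ▸ Set.mem_univ x)
  obtain ⟨b, hbC, hb⟩ := Set.mem_iUnion₂.1
    (hW.1 (Set.mem_biUnion (hFC (Set.mem_image_of_mem e ha)) ha))
  exact Set.disjoint_left.1 hCG hbC (Set.mem_image_of_mem e hb)

theorem stmt_11 {Y : Type*} [TopologicalSpace Y] [TopologicalSpace.MetrizableSpace Y]
    (hY : Cardinal.mk Y ≤ 2 ^ Cardinal.aleph0)
    {X : Type*} (M : MeasurableSpace X) (f g : X → Y)
    (hf : ∀ U : Set Y, IsOpen U → MeasurableSet[M] (f ⁻¹' U))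
    (hg : ∀ U : Set Y, IsOpen U → MeasurableSet[M] (g ⁻¹' U)) :
    MeasurableSet[M] {x | f x = g x} := by
  obtain ⟨𝒰, h𝒰, ho, hsep⟩ := exists_countable_isOpen_separating hY
  have heq : {x | f x = g x} = ⋂ U ∈ 𝒰, {x | x ∈ f ⁻¹' U ↔ x ∈ g ⁻¹' U} := by
    ext x
    simp only [Set.mem_ofPred_eq, Set.mem_iInter, Set.mem_preimage]
    exact ⟨fun h U _ => by rw [h], hsep _ _⟩
  rw [heq]
  exact MeasurableSet.biInter h𝒰 fun U hU => (hf U (ho U hU)).iff (hg U (ho U hU))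
end

section
/- For every metrizable topological space Y with cardinality at most 2^{ℵ₀}, the diagonal Δ_Y = {(y,y) : y ∈ Y} belongs to the product σ-algebra B(Y) ⊗ B(Y). -/
open MeasureTheory

/-- A union of closed sets in a metric space is closed if distinct members of the family are at
distance at least a fixed `δ > 0` from each other. -/
lemma isClosed_biUnion_of_separated {X ι : Type*} [MetricSpace X] {D : ι → Set X} {δ : ℝ}
    (hδ : 0 < δ) (hD : ∀ i, IsClosed (D i))
    (hsep : ∀ i j, i ≠ j → ∀ x ∈ D i, ∀ y ∈ D j, δ ≤ dist x y) (S : Set ι) :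
    IsClosed (⋃ i ∈ S, D i) := by
  have hfin : LocallyFinite D := fun x => by
    refine ⟨Metric.ball x (δ / 2), Metric.ball_mem_nhds x (half_pos hδ), Set.Subsingleton.finite ?_⟩
    rintro i ⟨a, ha, hax⟩ j ⟨b, hb, hbx⟩
    by_contra hij
    have h := hsep i j hij a ha b hb
    rw [Metric.mem_ball] at hax hbx
    linarith [dist_triangle_right a b x]
  rw [Set.biUnion_eq_iUnion]
  exact (hfin.comp_injective Subtype.val_injective).isClosed_iUnion fun i => hD i

/-- The set of points which lie in `V i` but in no earlier `V j`, and have distance at least `δ`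
from the complement of `V i`. -/
def firstMemberShrink {X ι : Type*} [MetricSpace X] (r : ι → ι → Prop) (V : ι → Set X) (δ : ℝ)
    (i : ι) : Set X :=
  {x | (∀ j, r j i → x ∉ V j) ∧ ∀ z, z ∉ V i → δ ≤ dist x z}

lemma isClosed_firstMemberShrink {X ι : Type*} [MetricSpace X] (r : ι → ι → Prop) {V : ι → Set X}
    (hV : ∀ i, IsOpen (V i)) (δ : ℝ) (i : ι) : IsClosed (firstMemberShrink r V δ i) := by
  simp only [firstMemberShrink, Set.ofPred_and, Set.ofPred_forall]
  refine IsClosed.inter ?_ ?_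
  · exact isClosed_iInter fun j => isClosed_iInter fun _ => (hV j).isClosed_compl
  · exact isClosed_iInter fun z => isClosed_iInter fun _ =>
      isClosed_le continuous_const (continuous_id.dist continuous_const)

/-- For a well-ordered open cover of a metric space, the map sending a point to the first member
of the cover that contains it is Borel measurable, even for the discrete σ-algebra on indices. -/
lemma measurableSet_preimage_first_member {X ι : Type*} [MetricSpace X] (r : ι → ι → Prop)
    [IsWellOrder ι r] {V : ι → Set X} (hV : ∀ i, IsOpen (V i)) {φ : X → ι}
    (hmem : ∀ x, x ∈ V (φ x)) (hmin : ∀ x i, r i (φ x) → x ∉ V i) (S : Set ι) :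
    MeasurableSet[borel X] (φ ⁻¹' S) := by
  borelize X
  have key : φ ⁻¹' S = ⋃ n : ℕ, ⋃ i ∈ S, firstMemberShrink r V (1 / ((n : ℝ) + 1)) i := by
    ext x
    simp only [Set.mem_preimage, Set.mem_iUnion, exists_prop]
    constructor
    · intro hx
      obtain ⟨ε, hε, hball⟩ := Metric.isOpen_iff.1 (hV (φ x)) x (hmem x)
      obtain ⟨n, hn⟩ := exists_nat_one_div_lt hε
      refine ⟨n, φ x, hx, hmin x, fun z hz => ?_⟩
      by_contra! h
      exact hz (hball (by rw [Metric.mem_ball']; exact h.trans hn))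
    · rintro ⟨n, i, hi, h₁, h₂⟩
      have hxi : x ∈ V i := by
        by_contra h
        have := h₂ x h
        rw [dist_self] at this
        exact absurd this (not_le.2 Nat.one_div_pos_of_nat)
      have : φ x = i := by
        rcases trichotomous_of r (φ x) i with h | h | h
        · exact absurd (hmem x) (h₁ _ h)
        · exact h
        · exact absurd hxi (hmin x i h)
      rwa [this]
  rw [key]
  refine MeasurableSet.iUnion fun n => (isClosed_biUnion_of_separated
    (Nat.one_div_pos_of_nat (n := n)) (isClosed_firstMemberShrink r hV _) ?_ S).measurableSet
  rintro i j hij x ⟨hx₁, hx₂⟩ y ⟨hy₁, hy₂⟩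
  rcases trichotomous_of r i j with h | h | h
  · exact hx₂ y (hy₁ i h)
  · exact absurd h hij
  · rw [dist_comm]
    exact hy₂ x (hx₁ j h)

/-- In a metric space, every point can be approximated within `ε` by a map to the space all of
whose preimages are Borel. -/
lemma exists_measurable_approx {X : Type*} [MetricSpace X] {ε : ℝ} (hε : 0 < ε) :
    ∃ φ : X → X, (∀ x, dist x (φ x) < ε) ∧ ∀ S : Set X, MeasurableSet[borel X] (φ ⁻¹' S) := by
  have wf : WellFounded (WellOrderingRel (α := X)) := IsWellFounded.wf
  have hne : ∀ x : X, {y | x ∈ Metric.ball y ε}.Nonempty := fun x => ⟨x, Metric.mem_ball_self hε⟩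
  have hmem : ∀ x, x ∈ Metric.ball (wf.min _ (hne x)) ε := fun x => wf.min_mem _ (hne x)
  exact ⟨fun x => wf.min _ (hne x), hmem, measurableSet_preimage_first_member WellOrderingRel
    (V := fun y => Metric.ball y ε) (fun _ => Metric.isOpen_ball) hmem
    fun x i hi h => wf.not_lt_min {y | x ∈ Metric.ball y ε} h hi⟩

theorem stmt_12 {Y : Type*} [TopologicalSpace Y] [TopologicalSpace.MetrizableSpace Y]
    (hY : Cardinal.mk Y ≤ 2 ^ Cardinal.aleph0) :
    MeasurableSet[(borel Y).prod (borel Y)] {p : Y × Y | p.1 = p.2} := by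
  let := TopologicalSpace.metrizableSpaceMetric Y
  borelize Y
  obtain ⟨g⟩ : Nonempty (Y ↪ ℝ) := by
    rw [← Cardinal.lift_mk_le', Cardinal.mk_real]
    simpa using hY
  choose φ hφ hφm using fun n : ℕ =>
    exists_measurable_approx (X := Y) (Nat.one_div_pos_of_nat (α := ℝ) (n := n))
  let f : Y → ℕ → ℝ := fun x n => g (φ n x)
  have hf : Measurable f := measurable_pi_lambda _ fun n s _ => hφm n (g ⁻¹' s)
  have hinj : Function.Injective f := fun x y hxy => by
    refine eq_of_forall_dist_le fun ε hε => ?_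
    obtain ⟨n, hn⟩ := exists_nat_one_div_lt (half_pos hε)
    have h : φ n x = φ n y := g.injective (congrFun hxy n)
    have hx := hφ n x
    have hy := hφ n y
    rw [← h] at hy
    linarith [dist_triangle_right x y (φ n x)]
  have h : {p : Y × Y | p.1 = p.2} = {p : Y × Y | f p.1 = f p.2} := by
    ext p
    exact hinj.eq_iff.symm
  rw [h]
  exact measurableSet_eq_fun (hf.comp measurable_fst) (hf.comp measurable_snd)
end

section
/- A metrizable topological space Y has the almost everywhere equality property (AEEP) if and only if the cardinality of Y is at most 2^{ℵ₀}. -/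
open MeasureTheory

universe u

/-- The sets of pairs whose membership depends on the first coordinate only through countably many
subsets of `Y`. -/
abbrev countablyDeterminedFst (Y : Type u) : MeasurableSpace (Y × Y) where
  MeasurableSet' S := ∃ A : ℕ → Set Y, ∀ y y', (∀ n, y ∈ A n ↔ y' ∈ A n) →
    ∀ z, (y, z) ∈ S ↔ (y', z) ∈ S
  measurableSet_empty := ⟨fun _ => ∅, by simp⟩
  measurableSet_compl := by
    rintro S ⟨A, hA⟩
    exact ⟨A, fun y y' h z => not_congr (hA y y' h z)⟩
  measurableSet_iUnion := by
    intro S hS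
    choose A hA using hS
    refine ⟨fun n => A n.unpair.1 n.unpair.2, fun y y' h z => ?_⟩
    simp only [Set.mem_iUnion]
    refine exists_congr fun i => hA i y y' (fun n => ?_) z
    simpa using h (Nat.pair i n)

theorem HasAEEP.mk_le {Y : Type u} [TopologicalSpace Y] (h : HasAEEP Y) :
    Cardinal.mk Y ≤ 2 ^ Cardinal.aleph0 := by
  obtain ⟨A, hA⟩ := h (Y × Y) (countablyDeterminedFst Y) Prod.fst Prod.snd
    (fun U _ => ⟨fun _ => U, fun y y' h z => h 0⟩)
    (fun U _ => ⟨fun _ => U, fun y y' h z => Iff.rfl⟩)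
  have hinj : Function.Injective
      (fun y => {n : ULift.{u} ℕ | y ∈ A n.down} : Y → Set (ULift.{u} ℕ)) := by
    intro y y' hyy
    have := (hA y y' (fun n => Set.ext_iff.1 hyy ⟨n⟩) y).1 rfl
    exact this.symm
  simpa using Cardinal.mk_le_of_injective hinj

section FirstCenter

variable {Y : Type u} [MetricSpace Y] [LinearOrder Y] {ε : ℝ} {i : Y → Y}

/-- If `i x` is the first center of an `ε`-ball containing `x`, then the points lying at depth `δ`
in their first ball, with the center in a prescribed set, form a closed set. -/
theorem isClosed_firstCenter_mem_of_depth (h1 : ∀ x, dist x (i x) < ε)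
    (h2 : ∀ x y, dist x y < ε → i x ≤ y) (S : Set Y) {δ : ℝ} (hδ : 0 < δ) :
    IsClosed {x | i x ∈ S ∧ dist x (i x) ≤ ε - δ} := by
  have key : ∀ p q, dist p (i p) ≤ ε - δ → dist p q < δ → i q ≤ i p := fun p q hp hpq =>
    h2 q _ (by linarith [dist_triangle q p (i p), dist_comm p q])
  refine isClosed_of_closure_subset fun x hx => ?_
  rw [Metric.mem_closure_iff] at hx
  obtain ⟨p, ⟨hpS, hp⟩, hxp⟩ := hx (δ / 2) (by linarith)
  have near : ∀ η > 0, ∃ q, i q = i p ∧ dist q (i p) ≤ ε - δ ∧ dist x q < η := by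
    intro η hη
    obtain ⟨q, ⟨_, hq⟩, hxq⟩ := hx (min η (δ / 2)) (lt_min hη (by linarith))
    have hxq' := hxq.trans_le (min_le_right _ _)
    have hpq : dist p q < δ := by linarith [dist_triangle p x q, dist_comm p x]
    have he : i q = i p := le_antisymm (key p q hp hpq) (key q p hq (by rwa [dist_comm]))
    exact ⟨q, he, he ▸ hq, hxq.trans_le (min_le_left _ _)⟩
  have hd : dist x (i p) ≤ ε - δ := by
    refine le_of_forall_pos_le_add fun η hη => ?_
    obtain ⟨q, -, hq, hxq⟩ := near η hη
    linarith [dist_triangle x q (i p)]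
  have he : i x = i p := by
    refine le_antisymm (h2 x _ (by linarith)) ?_
    obtain ⟨q, hqp, -, hxq⟩ := near (ε - dist x (i x)) (by linarith [h1 x])
    rw [← hqp]
    exact h2 q _ (by linarith [dist_triangle q x (i x), dist_comm q x])
  exact ⟨by rwa [he], by rwa [he]⟩

theorem measurableSet_firstCenter_mem [MeasurableSpace Y] [BorelSpace Y]
    (h1 : ∀ x, dist x (i x) < ε) (h2 : ∀ x y, dist x y < ε → i x ≤ y) (S : Set Y) :
    MeasurableSet {x | i x ∈ S} := by
  have : {x | i x ∈ S} = ⋃ n : ℕ, {x | i x ∈ S ∧ dist x (i x) ≤ ε - 1 / ((n : ℝ) + 1)} := by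
    ext x
    simp only [Set.mem_ofPred_eq, Set.mem_iUnion]
    refine ⟨fun hx => ?_, fun ⟨_, hx, _⟩ => hx⟩
    obtain ⟨n, hn⟩ := exists_nat_one_div_lt (sub_pos.2 (h1 x))
    exact ⟨n, hx, by linarith⟩
  rw [this]
  exact .iUnion fun n =>
    (isClosed_firstCenter_mem_of_depth h1 h2 S Nat.one_div_pos_of_nat).measurableSet

end FirstCenter

/-- A metric space of cardinality at most the continuum has a countable family of Borel sets
separating its points. -/
theorem exists_countable_borel_separating (Y : Type u) [MetricSpace Y] [MeasurableSpace Y]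
    [BorelSpace Y] (hY : Cardinal.mk Y ≤ 2 ^ Cardinal.aleph0) :
    ∃ B : ℕ × ULift.{u} ℕ → Set Y, (∀ n, MeasurableSet (B n)) ∧
      ∀ x y, (∀ n, x ∈ B n ↔ y ∈ B n) → x = y := by
  obtain ⟨c⟩ : Nonempty (Y ↪ Set (ULift.{u} ℕ)) := by
    rw [← Cardinal.le_def]
    simpa using hY
  obtain ⟨_, _⟩ := exists_wellFoundedLT Y
  have hi : ∀ n : ℕ, ∃ i : Y → Y, (∀ x, dist x (i x) < 1 / ((n : ℝ) + 1)) ∧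
      ∀ x y, dist x y < 1 / ((n : ℝ) + 1) → i x ≤ y := by
    intro n
    have hne : ∀ x : Y, {y | dist x y < 1 / ((n : ℝ) + 1)}.Nonempty := fun x =>
      ⟨x, by simpa using Nat.cast_add_one_pos n⟩
    exact ⟨fun x => wellFounded_lt.min _ (hne x), fun x => wellFounded_lt.min_mem _ (hne x),
      fun x y hy => not_lt.1 (wellFounded_lt.not_lt_min {y | dist x y < 1 / ((n : ℝ) + 1)} hy)⟩
  choose i h1 h2 using hi
  refine ⟨fun n => {x | i n.1 x ∈ {y | n.2 ∈ c y}},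
    fun n => measurableSet_firstCenter_mem (h1 n.1) (h2 n.1) _, fun x y hxy => ?_⟩
  refine dist_le_zero.1 (le_of_forall_pos_le_add fun η hη => ?_)
  obtain ⟨n, hn⟩ := exists_nat_one_div_lt (half_pos hη)
  have he : i n x = i n y := c.injective (Set.ext fun k => hxy (n, k))
  have hx := h1 n x
  have hy := h1 n y
  rw [he] at hx
  linarith [dist_triangle_right x y (i n y)]

theorem hasAEEP_of_mk_le {Y : Type u} [TopologicalSpace Y] [TopologicalSpace.MetrizableSpace Y]
    (hY : Cardinal.mk Y ≤ 2 ^ Cardinal.aleph0) : HasAEEP Y := by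
  let := TopologicalSpace.metrizableSpaceMetric Y
  borelize Y
  obtain ⟨B, hB, hsep⟩ := exists_countable_borel_separating Y hY
  intro X M f g hf hg
  have hf' : Measurable f := measurable_of_isOpen hf
  have hg' : Measurable g := measurable_of_isOpen hg
  have : {x | f x = g x} = ⋂ n, {x | f x ∈ B n ↔ g x ∈ B n} := by
    ext x
    simp only [Set.mem_ofPred_eq, Set.mem_iInter]
    exact ⟨fun h n => by rw [h], hsep _ _⟩
  rw [this]
  exact .iInter fun n => (hf' (hB n)).iff (hg' (hB n))

theorem stmt_13 (Y : Type u) [TopologicalSpace Y] [TopologicalSpace.MetrizableSpace Y] :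
    HasAEEP Y ↔ Cardinal.mk Y ≤ 2 ^ Cardinal.aleph0 :=
  ⟨HasAEEP.mk_le, hasAEEP_of_mk_le⟩
end

section
/- A metrizable topological space Y has the almost everywhere equality property (AEEP) if and only if the topological weight of Y is at most 2^{ℵ₀}. -/
open MeasureTheory

universe u

/-- The topological weight of a topological space: the least cardinality of a base
for its topology. -/
noncomputable def topWeight (Y : Type u) [TopologicalSpace Y] : Cardinal.{u} :=
  ⨅ B : {B : Set (Set Y) // TopologicalSpace.IsTopologicalBasis B}, Cardinal.mk B.1

theorem topWeight_le_mk {Y : Type u} [TopologicalSpace Y] {B : Set (Set Y)}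
    (hB : TopologicalSpace.IsTopologicalBasis B) : topWeight Y ≤ Cardinal.mk B :=
  ciInf_le' (fun B : {B : Set (Set Y) // TopologicalSpace.IsTopologicalBasis B} =>
    Cardinal.mk B.1) ⟨B, hB⟩

theorem exists_isTopologicalBasis_mk_eq_topWeight (Y : Type u) [TopologicalSpace Y] :
    ∃ B : Set (Set Y), TopologicalSpace.IsTopologicalBasis B ∧ Cardinal.mk B = topWeight Y := by
  have : Nonempty {B : Set (Set Y) // TopologicalSpace.IsTopologicalBasis B} :=
    ⟨⟨_, TopologicalSpace.isTopologicalBasis_opens⟩⟩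
  obtain ⟨B, hB⟩ := ciInf_mem
    fun B : {B : Set (Set Y) // TopologicalSpace.IsTopologicalBasis B} => Cardinal.mk B.1
  exact ⟨B.1, B.2, hB⟩

theorem topWeight_le_mk_mul_aleph0 (Y : Type u) [TopologicalSpace Y]
    [TopologicalSpace.MetrizableSpace Y] :
    topWeight Y ≤ Cardinal.mk Y * Cardinal.aleph0 := by
  let := TopologicalSpace.metrizableSpaceMetric Y
  have hB : TopologicalSpace.IsTopologicalBasis
      (Set.range fun p : Y × ℕ => Metric.ball p.1 (1 / ((p.2 : ℝ) + 1))) := by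
    refine TopologicalSpace.isTopologicalBasis_of_isOpen_of_nhds ?_ ?_
    · rintro _ ⟨p, rfl⟩
      exact Metric.isOpen_ball
    · intro x U hx hU
      obtain ⟨ε, hε, hεU⟩ := Metric.isOpen_iff.1 hU x hx
      obtain ⟨n, hn⟩ := exists_nat_one_div_lt hε
      exact ⟨_, ⟨(x, n), rfl⟩, Metric.mem_ball_self Nat.one_div_pos_of_nat,
        (Metric.ball_subset_ball hn.le).trans hεU⟩
  refine (topWeight_le_mk hB).trans (Cardinal.mk_range_le.trans ?_)
  simp

theorem hasAEEP_of_countable_separating {Y : Type u} [TopologicalSpace Y] {ι : Type*} [Countable ι]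
    (E : ι → Set Y) (hE : ∀ i, MeasurableSet[borel Y] (E i))
    (hsep : ∀ x y, (∀ i, x ∈ E i ↔ y ∈ E i) → x = y) : HasAEEP Y := by
  intro X M f g hf hg
  let : MeasurableSpace Y := borel Y
  have hf' : Measurable f := measurable_generateFrom hf
  have hg' : Measurable g := measurable_generateFrom hg
  have heq : {x | f x = g x} = ⋂ i, {x | f x ∈ E i ↔ g x ∈ E i} := by
    ext x
    simp only [Set.mem_ofPred_eq, Set.mem_iInter]
    exact ⟨fun h i => by rw [h], hsep _ _⟩
  rw [heq]
  exact MeasurableSet.iInter fun i => MeasurableSet.iff (hf' (hE i)) (hg' (hE i))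

/-- The points whose first `r`-close center in the well-ordered family `c` has index in `S`. -/
def firstCenterIn {Y I : Type*} [Dist Y] [LT I] (c : I → Y) (r : ℝ) (S : Set I) : Set Y :=
  {x | ∃ i ∈ S, (∀ j < i, r ≤ dist x (c j)) ∧ dist x (c i) < r}

theorem mem_firstCenterIn_iff {Y I : Type*} [Dist Y] [LinearOrder I] {c : I → Y} {r : ℝ}
    {S : Set I} {x : Y} {i : I} (hlt : ∀ j < i, r ≤ dist x (c j)) (hi : dist x (c i) < r) :
    x ∈ firstCenterIn c r S ↔ i ∈ S := by
  refine ⟨?_, fun h => ⟨i, h, hlt, hi⟩⟩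
  rintro ⟨j, hjS, hjlt, hj⟩
  rcases lt_trichotomy i j with h | rfl | h
  · exact absurd hi (hjlt i h).not_gt
  · exact hjS
  · exact absurd hj (hlt j h).not_gt

theorem isClosed_iUnion_firstCenter {Y I : Type*} [PseudoMetricSpace Y] [LinearOrder I]
    (c : I → Y) (r : ℝ) {δ : ℝ} (hδ : 0 < δ) (S : Set I) :
    IsClosed (⋃ i : S, {x | (∀ j < (i : I), r ≤ dist x (c j)) ∧ dist x (c i) ≤ r - δ}) := by
  have hlt : ∀ {i j : I} {x y : Y}, i < j → dist x (c i) ≤ r - δ →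
      (∀ k < j, r ≤ dist y (c k)) → δ ≤ dist x y := by
    intro i j x y hij hx hy
    have := dist_triangle_left y (c i) x
    linarith [hy i hij]
  refine LocallyFinite.isClosed_iUnion (fun x => ?_) fun i => ?_
  · refine ⟨Metric.ball x (δ / 2), Metric.ball_mem_nhds x (half_pos hδ), ?_⟩
    refine Set.Subsingleton.finite ?_
    rintro i ⟨y, ⟨hy, hyi⟩, hyx⟩ j ⟨z, ⟨hz, hzj⟩, hzx⟩
    have hyz : dist y z < δ := by
      have := dist_triangle_right y z x
      linarith [Metric.mem_ball.1 hyx, Metric.mem_ball.1 hzx]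
    rcases lt_trichotomy (i : I) j with h | h | h
    · exact absurd (hlt h hyi hz) hyz.not_ge
    · exact Subtype.ext h
    · exact absurd (hlt h hzj hy) (dist_comm y z ▸ hyz).not_ge
  · simp only [Set.ofPred_and, Set.ofPred_forall]
    refine IsClosed.inter (isClosed_iInter fun j => isClosed_iInter fun _ => ?_) ?_
    · exact isClosed_le continuous_const (by fun_prop)
    · exact isClosed_le (by fun_prop) continuous_const

theorem measurableSet_firstCenterIn {Y I : Type*} [PseudoMetricSpace Y] [LinearOrder I]
    (c : I → Y) (r : ℝ) (S : Set I) : MeasurableSet[borel Y] (firstCenterIn c r S) := by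
  borelize Y
  have heq : firstCenterIn c r S = ⋃ n : ℕ, ⋃ i : S,
      {x | (∀ j < (i : I), r ≤ dist x (c j)) ∧ dist x (c i) ≤ r - 1 / ((n : ℝ) + 1)} := by
    ext x
    simp only [firstCenterIn, Set.mem_iUnion, Set.mem_ofPred_eq]
    constructor
    · rintro ⟨i, hiS, hlt, hi⟩
      obtain ⟨n, hn⟩ := exists_nat_one_div_lt (sub_pos.2 hi)
      exact ⟨n, ⟨i, hiS⟩, hlt, by linarith⟩
    · rintro ⟨n, i, hlt, hi⟩
      have : 0 < 1 / ((n : ℝ) + 1) := Nat.one_div_pos_of_nat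
      exact ⟨i, i.2, hlt, by linarith⟩
  rw [heq]
  exact MeasurableSet.iUnion fun n =>
    (isClosed_iUnion_firstCenter c r Nat.one_div_pos_of_nat S).measurableSet

theorem hasAEEP_of_denseRange {Y : Type u} [MetricSpace Y] {I : Type*} {c : I → Y}
    (hc : DenseRange c) (φ : I ↪ Set ℕ) : HasAEEP Y := by
  let : LinearOrder I := IsWellOrder.linearOrder WellOrderingRel
  have : WellFoundedLT I := ⟨(inferInstance : IsWellFounded I WellOrderingRel).wf⟩
  have hfirst : ∀ (x : Y) {r : ℝ}, 0 < r →
      ∃ i, (∀ j < i, r ≤ dist x (c j)) ∧ dist x (c i) < r := by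
    intro x r hr
    obtain ⟨i, hi, hmin⟩ := wellFounded_lt.has_min {i | dist x (c i) < r} (hc.exists_dist_lt x hr)
    exact ⟨i, fun j hj => not_lt.1 fun h => hmin j h hj, hi⟩
  refine hasAEEP_of_countable_separating
    (fun p : ℕ × ℕ => firstCenterIn c (1 / ((p.1 : ℝ) + 1)) {i | p.2 ∈ φ i})
    (fun p => measurableSet_firstCenterIn _ _ _) fun x y hxy => ?_
  by_contra hne
  obtain ⟨m, hm⟩ := exists_nat_one_div_lt (half_pos (dist_pos.2 hne))
  obtain ⟨i, hilt, hi⟩ := hfirst x (r := 1 / ((m : ℝ) + 1)) Nat.one_div_pos_of_nat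
  obtain ⟨j, hjlt, hj⟩ := hfirst y (r := 1 / ((m : ℝ) + 1)) Nat.one_div_pos_of_nat
  have hij : i = j := φ.injective <| Set.ext fun n =>
    (mem_firstCenterIn_iff hilt hi).symm.trans <|
      (hxy (m, n)).trans (mem_firstCenterIn_iff hjlt hj)
  subst hij
  linarith [dist_triangle_right x y (c i)]

theorem TopologicalSpace.IsTopologicalBasis.exists_denseRange {Y : Type*} [TopologicalSpace Y]
    {B : Set (Set Y)} (hB : TopologicalSpace.IsTopologicalBasis B) :
    ∃ c : {s : B // (s : Set Y).Nonempty} → Y, DenseRange c :=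
  ⟨fun s => s.2.some, hB.dense_iff.2 fun s hs hne =>
    ⟨_, Set.Nonempty.some_mem hne, ⟨⟨⟨s, hs⟩, hne⟩, rfl⟩⟩⟩

theorem stmt_15 (Y : Type u) [TopologicalSpace Y] [TopologicalSpace.MetrizableSpace Y] :
    HasAEEP Y ↔ topWeight Y ≤ 2 ^ Cardinal.aleph0 := by
  constructor
  · intro h
    refine (topWeight_le_mk_mul_aleph0 Y).trans ?_
    refine (mul_le_mul' h.mk_le (Cardinal.cantor _).le).trans_eq ?_
    rw [← Cardinal.power_add, Cardinal.aleph0_add_aleph0]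
  · intro h
    obtain ⟨B, hB, hBcard⟩ := exists_isTopologicalBasis_mk_eq_topWeight Y
    obtain ⟨c, hc⟩ := hB.exists_denseRange
    have hle : Cardinal.mk B ≤ Cardinal.mk (ULift.{u} (Set ℕ)) := by simpa [hBcard] using h
    obtain ⟨φ⟩ := hle
    let := TopologicalSpace.metrizableSpaceMetric Y
    exact hasAEEP_of_denseRange hc
      ((Function.Embedding.subtype _).trans (φ.trans Equiv.ulift.toEmbedding))
end

section
/- For a metrizable topological space Y, the diagonal Δ_Y = {(y,y) : y ∈ Y} belongs to the product σ-algebra B(Y) ⊗ B(Y) if and only if the cardinality of Y is at most 2^{ℵ₀}. -/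
open MeasureTheory

/-- For every measurable set `s` of a product there are countably many sets such that membership
of `(x, y)` in `s` depends only on which of these sets contain `x` and `y`. -/
lemma exists_seq_saturated_of_measurableSet_prod {α : Type*} (m : MeasurableSpace α)
    {s : Set (α × α)} (hs : MeasurableSet[m.prod m] s) :
    ∃ A : ℕ → Set α, ∀ x x' y y' : α, (∀ n, x ∈ A n ↔ x' ∈ A n) → (∀ n, y ∈ A n ↔ y' ∈ A n) →
      ((x, y) ∈ s ↔ (x', y') ∈ s) := by
  have hs' : MeasurableSet s := hs
  rw [← generateFrom_prod (α := α) (β := α)] at hs'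
  induction s, hs' using MeasurableSpace.generateFrom_induction with
  | hC t ht _ =>
    obtain ⟨u, -, v, -, rfl⟩ := ht
    refine ⟨fun n => if n = 0 then u else v, fun x x' y y' hx hy => ?_⟩
    have h₀ : x ∈ u ↔ x' ∈ u := by simpa using hx 0
    have h₁ : y ∈ v ↔ y' ∈ v := by simpa using hy 1
    simp only [Set.mem_prod, h₀, h₁]
  | empty => exact ⟨fun _ => ∅, by simp⟩
  | compl t ht ih =>
    obtain ⟨A, hA⟩ := ih (by rw [generateFrom_prod] at ht; exact ht)
    exact ⟨A, fun x x' y y' hx hy => not_congr (hA x x' y y' hx hy)⟩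
  | iUnion t ht ih =>
    choose A hA using fun n => ih n (by have := ht n; rw [generateFrom_prod] at this; exact this)
    refine ⟨fun n => A n.unpair.1 n.unpair.2, fun x x' y y' hx hy => ?_⟩
    simp only [Set.mem_iUnion]
    refine exists_congr fun i => hA i x x' y y' (fun n => ?_) fun n => ?_
    · simpa using hx (Nat.pair i n)
    · simpa using hy (Nat.pair i n)

lemma mk_le_continuum_of_measurableSet_diagonal {α : Type*} (m : MeasurableSpace α)
    (h : MeasurableSet[m.prod m] {p : α × α | p.1 = p.2}) :
    Cardinal.mk α ≤ 2 ^ Cardinal.aleph0 := by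
  obtain ⟨A, hA⟩ := exists_seq_saturated_of_measurableSet_prod m h
  have hinj : Function.Injective (fun x : α => {n | x ∈ A n}) := fun x y hxy =>
    (hA x x x y (fun _ => Iff.rfl) (fun n => Set.ext_iff.1 hxy n)).1 rfl
  simpa using Cardinal.lift_mk_le_lift_mk_of_injective hinj

/-- In a metric space, the identity can be uniformly approximated by maps all of whose preimages
are Borel: send `x` to the least centre, for a well-order, of a ball of radius `r` containing
`x`. -/
lemma exists_dist_lt_forall_measurableSet_preimage {α : Type*} [PseudoMetricSpace α]
    [MeasurableSpace α] [OpensMeasurableSpace α] {r : ℝ} (hr : 0 < r) :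
    ∃ f : α → α, (∀ x, dist x (f x) < r) ∧ ∀ S : Set α, MeasurableSet (f ⁻¹' S) := by
  obtain ⟨_, _⟩ := exists_wellFoundedLT α
  have hne (x : α) : {y | dist x y < r}.Nonempty := ⟨x, by simpa using hr⟩
  let f (x : α) : α := wellFounded_lt.min {y | dist x y < r} (hne x)
  have hf (x : α) : dist x (f x) < r := wellFounded_lt.min_mem _ (hne x)
  have hmin {x y : α} (h : y < f x) : r ≤ dist x y :=
    not_lt.1 fun hlt => wellFounded_lt.not_lt_min {y | dist x y < r} hlt h
  refine ⟨f, hf, fun S => ?_⟩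
  let E (k : ℕ) (y : α) : Set α :=
    {x | dist x y ≤ r - 1 / (k + 1)} ∩ ⋂ z ∈ Set.Iio y, {x | r ≤ dist x z}
  have hE (k : ℕ) (y : α) : IsClosed (E k y) :=
    (isClosed_le (by fun_prop) (by fun_prop)).inter
      (isClosed_biInter fun z _ => isClosed_le (by fun_prop) (by fun_prop))
  have hsep {k : ℕ} {y z u v : α} (hyz : y < z) (hu : u ∈ E k y) (hv : v ∈ E k z) :
      1 / ((k : ℝ) + 1) ≤ dist u v := by
    have h₁ : dist u y ≤ r - 1 / (k + 1) := hu.1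
    have h₂ : r ≤ dist v y := Set.mem_iInter₂.1 hv.2 y hyz
    linarith [dist_triangle_left v y u]
  have hlf (k : ℕ) : LocallyFinite fun y : S => E k y := fun x => by
    have hk : 0 < 1 / ((k : ℝ) + 1) / 2 := by positivity
    refine ⟨Metric.ball x (1 / ((k : ℝ) + 1) / 2), Metric.ball_mem_nhds _ hk,
      Set.Subsingleton.finite ?_⟩
    rintro ⟨y, _⟩ ⟨u, hu, hux⟩ ⟨z, _⟩ ⟨v, hv, hvx⟩
    rw [Metric.mem_ball] at hux hvx
    have huv := dist_triangle_right u v x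
    rcases lt_trichotomy y z with h | h | h
    · linarith [hsep h hu hv]
    · exact Subtype.ext h
    · linarith [hsep h hv hu, dist_comm u v]
  have hpre : f ⁻¹' S = ⋃ k, ⋃ y : S, E k y := by
    ext x
    simp only [Set.mem_preimage, Set.mem_iUnion]
    constructor
    · intro hx
      obtain ⟨k, hk⟩ := exists_nat_one_div_lt (sub_pos.2 (hf x))
      refine ⟨k, ⟨f x, hx⟩, ?_, Set.mem_iInter₂.2 fun z hz => hmin hz⟩
      change dist x (f x) ≤ r - 1 / (k + 1)
      linarith
    · rintro ⟨k, ⟨y, hy⟩, hxy, hx⟩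
      have hlt : dist x y < r := by
        have : 0 < 1 / ((k : ℝ) + 1) := by positivity
        have : dist x y ≤ r - 1 / (k + 1) := hxy
        linarith
      have : f x = y := by
        refine le_antisymm (not_lt.1 fun h => ?_) (not_lt.1 fun h => ?_)
        · exact (hmin h).not_gt hlt
        · exact (hf x).not_ge (Set.mem_iInter₂.1 hx (f x) h)
      rwa [this]
  rw [hpre]
  exact .iUnion fun k => ((hlf k).isClosed_iUnion fun y => hE k y).measurableSet

lemma measurableSet_diagonal_of_mk_le_continuum {α : Type*} [MetricSpace α]
    [MeasurableSpace α] [OpensMeasurableSpace α] (h : Cardinal.mk α ≤ 2 ^ Cardinal.aleph0) :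
    MeasurableSet {p : α × α | p.1 = p.2} := by
  obtain ⟨g⟩ : Nonempty (α ↪ (ℕ → Bool)) := by
    rw [← Cardinal.lift_mk_le']
    simpa using h
  choose f hf hfm using fun n : ℕ =>
    exists_dist_lt_forall_measurableSet_preimage (α := α) (Nat.one_div_pos_of_nat (n := n) (α := ℝ))
  let F (x : α) (n : ℕ) : ℕ → Bool := g (f n x)
  have hF : Measurable F := measurable_pi_lambda _ fun n s _ => hfm n (g ⁻¹' s)
  have hinj : Function.Injective F := fun x y hxy => by
    have hn (n : ℕ) : f n x = f n y := g.injective (congrFun hxy n)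
    refine dist_le_zero.1 (le_of_forall_pos_lt_add fun ε hε => ?_)
    obtain ⟨n, hε⟩ := exists_nat_one_div_lt (half_pos hε)
    have hx := hf n x
    rw [hn n] at hx
    linarith [dist_triangle_right x y (f n y), hf n y]
  have := measurableSet_eq_fun (hF.comp (measurable_fst (β := α))) (hF.comp measurable_snd)
  simpa [hinj.eq_iff] using this

theorem stmt_16 (Y : Type*) [TopologicalSpace Y] [TopologicalSpace.MetrizableSpace Y] :
    MeasurableSet[(borel Y).prod (borel Y)] {p : Y × Y | p.1 = p.2} ↔
      Cardinal.mk Y ≤ 2 ^ Cardinal.aleph0 := by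
  refine ⟨mk_le_continuum_of_measurableSet_diagonal _, fun h => ?_⟩
  let := TopologicalSpace.metrizableSpaceMetric Y
  borelize Y
  exact measurableSet_diagonal_of_mk_le_continuum h
end

section
/- Let (Y, N) be a measurable space. Every member F of the product σ-algebra N ⊗ N on Y × Y may be written in the form F = ⋃_{t ∈ T} (A_t × B_t) for some index set T of cardinality at most 2^{ℵ₀}, where A_t, B_t ∈ N for every t ∈ T. -/
open MeasureTheory

universe u

/-- Membership in a measurable subset of a product depends only on the membership of both
coordinates in the sets of some countable measurable family. -/
theorem exists_seq_measurableSet_forall_mem_iff_of_prod {Y : Type*} [MeasurableSpace Y]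
    {F : Set (Y × Y)} (hF : MeasurableSet F) :
    ∃ C : ℕ → Set Y, (∀ n, MeasurableSet (C n)) ∧
      ∀ p q : Y × Y, (∀ n, p.1 ∈ C n ↔ q.1 ∈ C n) → (∀ n, p.2 ∈ C n ↔ q.2 ∈ C n) →
        (p ∈ F ↔ q ∈ F) := by
  rw [← generateFrom_prod] at hF
  induction hF with
  | basic s hs =>
    obtain ⟨A, hA, B, hB, rfl⟩ := hs
    refine ⟨fun n => if n = 0 then A else B, fun n => ?_, fun p q h₁ h₂ => ?_⟩
    · dsimp only
      split_ifs
      exacts [hA, hB]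
    · have hA' := h₁ 0
      have hB' := h₂ 1
      simp only [if_true, one_ne_zero, if_false] at hA' hB'
      rw [Set.mem_prod, Set.mem_prod, hA', hB']
  | empty => exact ⟨fun _ => ∅, fun _ => .empty, fun _ _ _ _ => Iff.rfl⟩
  | compl s _ ih =>
    obtain ⟨C, hC, h⟩ := ih
    exact ⟨C, hC, fun p q h₁ h₂ => not_congr (h p q h₁ h₂)⟩
  | iUnion s _ ih =>
    choose C hC h using ih
    refine ⟨fun n => C n.unpair.1 n.unpair.2, fun n => hC _ _, fun p q h₁ h₂ => ?_⟩
    simp only [Set.mem_iUnion]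
    refine exists_congr fun i => h i p q (fun n => ?_) (fun n => ?_)
    · simpa using h₁ (Nat.pair i n)
    · simpa using h₂ (Nat.pair i n)

theorem measurableSet.ofPred_forall_mem_iff {Y ι : Type*} [MeasurableSpace Y] [Countable ι]
    {C : ι → Set Y} (hC : ∀ i, MeasurableSet (C i)) (s : Set ι) :
    MeasurableSet {y | ∀ i, y ∈ C i ↔ i ∈ s} := by
  rw [Set.ofPred_forall]
  refine .iInter fun i => ?_
  by_cases hi : i ∈ s
  · simpa [hi] using hC i
  · simp only [hi, iff_false]
    exact (hC i).compl

theorem stmt_17 {Y : Type u} (N : MeasurableSpace Y) (F : Set (Y × Y))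
    (hF : MeasurableSet[N.prod N] F) :
    ∃ (T : Type u), Cardinal.mk T ≤ 2 ^ Cardinal.aleph0 ∧
      ∃ A B : T → Set Y,
        (∀ t, MeasurableSet[N] (A t)) ∧ (∀ t, MeasurableSet[N] (B t)) ∧
        F = ⋃ t, A t ×ˢ B t := by
  obtain ⟨C, hC, h⟩ := exists_seq_measurableSet_forall_mem_iff_of_prod hF
  let cell (s : Set ℕ) : Set Y := {y | ∀ n, y ∈ C n ↔ n ∈ s}
  have hcell (s : Set ℕ) : MeasurableSet (cell s) := measurableSet.ofPred_forall_mem_iff hC s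
  refine ⟨ULift.{u} {t : Set ℕ × Set ℕ // ∃ p ∈ F, p.1 ∈ cell t.1 ∧ p.2 ∈ cell t.2}, ?_,
    fun t => cell t.down.1.1, fun t => cell t.down.1.2, fun _ => hcell _, fun _ => hcell _, ?_⟩
  · rw [Cardinal.mk_uLift, ← Cardinal.lift_aleph0.{u, 0}, ← Cardinal.lift_two.{u, 0},
      ← Cardinal.lift_power, Cardinal.lift_le]
    refine (Cardinal.mk_subtype_le _).trans ?_
    simp
  · ext p
    simp only [Set.mem_iUnion, Set.mem_prod]
    constructor
    · intro hp
      exact ⟨⟨({n | p.1 ∈ C n}, {n | p.2 ∈ C n}), p, hp, fun _ => Iff.rfl, fun _ => Iff.rfl⟩,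
        fun _ => Iff.rfl, fun _ => Iff.rfl⟩
    · rintro ⟨⟨t, q, hq, hq₁, hq₂⟩, hp₁, hp₂⟩
      exact (h p q (fun n => (hp₁ n).trans (hq₁ n).symm)
        fun n => (hp₂ n).trans (hq₂ n).symm).2 hq
end
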